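/- Let κ be an infinite cardinal and let X be a topological space in which every point-finite family of nonempty functionally open sets has cardinality at most κ. Let T be a set, let Y ⊆ ℝ^T be a compact subspace, let B = {y ∈ Y : |supp y| ≤ κ}, and let f : X × Y → ℝ be separately continuous. Then for every ε > 0 there exists a set R ⊆ T with |R| ≤ κ such that for all b', b'' ∈ B with b'|_R = b''|_R one has |f(x,b') − f(x,b'')| ≤ ε for every x ∈ X. -/

import Mathlib

open Cardinal Set

universe u v

/-- A subset `A` of a topological space is *functionally open* if `A = g⁻¹((0,1])`
for some continuous `g : X → [0,1]`. -/
def FunctionallyOpen {X : Type u} [TopologicalSpace X] (A : Set X) : Prop :=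
  ∃ g : X → ℝ, Continuous g ∧ (∀ x, g x ∈ Set.Icc (0 : ℝ) 1) ∧ A = g ⁻¹' Set.Ioc (0 : ℝ) 1

/-- A family of sets is *point-finite* if every point belongs to only finitely many members. -/
def PointFinite {X : Type u} (𝒰 : Set (Set X)) : Prop :=
  ∀ x : X, {U ∈ 𝒰 | x ∈ U}.Finite

/-- The point-finite cellularity `p(X)`: the supremum of the cardinalities of
point-finite families of nonempty open subsets of `X`. -/
noncomputable def pCell (X : Type u) [TopologicalSpace X] : Cardinal.{u} :=
  ⨆ 𝒰 : {𝒰 : Set (Set X) // (∀ U ∈ 𝒰, IsOpen U ∧ U.Nonempty) ∧ PointFinite 𝒰},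
    Cardinal.mk ↥𝒰.1

/-- The cellularity `c(X)`: the supremum of the cardinalities of disjoint families of
nonempty open subsets of `X`. -/
noncomputable def cellularity (X : Type u) [TopologicalSpace X] : Cardinal.{u} :=
  ⨆ 𝒰 : {𝒰 : Set (Set X) // (∀ U ∈ 𝒰, IsOpen U ∧ U.Nonempty) ∧ 𝒰.PairwiseDisjoint id},
    Cardinal.mk ↥𝒰.1

/-- The weight `w(X)`: the least infinite cardinality of a base of the topology of `X`. -/
noncomputable def tWeight (X : Type u) [TopologicalSpace X] : Cardinal.{u} :=
  ⨅ B : {B : Set (Set X) // TopologicalSpace.IsTopologicalBasis B},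
    max Cardinal.aleph0 (Cardinal.mk ↥B.1)

/-- The density `d(X)`: the least infinite cardinality of a dense subset of `X`. -/
noncomputable def tDensity (X : Type u) [TopologicalSpace X] : Cardinal.{u} :=
  ⨅ D : {D : Set X // Dense D}, max Cardinal.aleph0 (Cardinal.mk ↥D.1)

/-- `C_p(X)`: the continuous real valued functions on `X`, as a subspace of `ℝ^X` with
the product topology, i.e. with the topology of pointwise convergence. -/
def Cp (X : Type u) [TopologicalSpace X] : Set (X → ℝ) := {f | Continuous f}

/-- A compact space is *Valdivia* if it is homeomorphic to a compact subspace `Z ⊆ ℝ^T`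
for some set `T` such that the countably supported elements of `Z` are dense in `Z`. -/
def IsValdivia (Y : Type u) [TopologicalSpace Y] : Prop :=
  CompactSpace Y ∧ ∃ (T : Type u) (Z : Set (T → ℝ)), IsCompact Z ∧
    Dense {z : ↥Z | Set.Countable {t : T | (z : T → ℝ) t ≠ 0}} ∧ Nonempty (Y ≃ₜ ↥Z)

/-- A compact space is *Eberlein* if it is homeomorphic to a weakly compact subset of a
Banach space. -/
def IsEberlein (Y : Type u) [TopologicalSpace Y] : Prop :=
  CompactSpace Y ∧ ∃ (E : Type u) (_ : NormedAddCommGroup E) (_ : NormedSpace ℝ E)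
    (_ : CompleteSpace E), ∃ K : Set (WeakSpace ℝ E), IsCompact K ∧ Nonempty (Y ≃ₜ ↥K)

open Filter Topology

/-- Strict superlevel sets of `|g|`, for `g` continuous, are functionally open. -/
lemma functionallyOpen_setOf_lt_abs {X : Type u} [TopologicalSpace X] {g : X → ℝ}
    (hg : Continuous g) (ε : ℝ) : FunctionallyOpen {x | ε < |g x|} := by
  refine ⟨fun x => min 1 (max 0 (|g x| - ε)), by fun_prop, fun x => ⟨by positivity,
    min_le_left _ _⟩, ?_⟩
  ext x
  simp

/-- A union of at most `κ` sets of size at most `κ` has size at most `κ`, for `κ` infinite. -/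
lemma mk_iUnion_le_of_le {α ι : Type u} {κ : Cardinal.{u}} (hκ : ℵ₀ ≤ κ) {A : ι → Set α}
    (hι : #ι ≤ κ) (hA : ∀ i, #(A i) ≤ κ) : #(⋃ i, A i) ≤ κ :=
  (mk_iUnion_le A).trans ((mul_le_mul' hι (ciSup_le' hA)).trans (mul_eq_self hκ).le)

/-- If the members of an indexed family of nonempty sets are point-finite with respect to the
indices, then the index set is no larger than an infinite bound on the set of members. -/
lemma mk_le_of_finite_indices {X I : Type u} {κ : Cardinal.{u}} (hκ : ℵ₀ ≤ κ) (U : I → Set X)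
    (hne : ∀ i, (U i).Nonempty) (hfin : ∀ x, {i | x ∈ U i}.Finite) (hU : #(range U) ≤ κ) :
    #I ≤ κ := by
  have hcov : (⋃ s : range U, U ⁻¹' {s.1}) = Set.univ := by
    ext i
    simp
  rw [← mk_univ, ← hcov]
  have hfib : ∀ s : range U, #(U ⁻¹' {s.1}) ≤ κ := by
    rintro ⟨_, i, rfl⟩
    obtain ⟨x, hx⟩ := hne i
    refine (Set.Finite.lt_aleph0 ((hfin x).subset ?_)).le.trans hκ
    rintro j (hj : U j = U i)
    change x ∈ U j
    rwa [hj]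
  exact mk_iUnion_le_of_le hκ hU hfib

/-- Let `a i` and `b i` agree on `S i`, where the sets `S i` increase and absorb the supports of
all earlier points. Then a continuous function separates `a i` from `b i` by more than `ε` for
only finitely many `i`. -/
lemma finite_setOf_lt_abs_sub {T I : Type u} [LinearOrder I] [WellFoundedLT I]
    {Y : Set (T → ℝ)} (hY : IsCompact Y) (a b : I → Y) (S : I → Set T) (hS : Monotone S)
    (hab : ∀ i, ∀ t ∈ S i, (a i : T → ℝ) t = (b i : T → ℝ) t)
    (ha : ∀ i j, i < j → {t | (a i : T → ℝ) t ≠ 0} ⊆ S j)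
    (hb : ∀ i j, i < j → {t | (b i : T → ℝ) t ≠ 0} ⊆ S j)
    {g : Y → ℝ} (hg : Continuous g) {ε : ℝ} (hε : 0 < ε) :
    {i | ε < |g (a i) - g (b i)|}.Finite := by
  by_contra hinf
  have : CompactSpace Y := isCompact_iff_compactSpace.mp hY
  let e := Set.Infinite.natEmbedding _ hinf
  obtain ⟨φ, hφ⟩ := exists_increasing_or_nonincreasing_subseq (· < ·) fun n => (e n : I)
  replace hφ : ∀ m n, m < n → (e (φ m) : I) < e (φ n) := by
    refine hφ.resolve_right fun h => ?_
    have hdec : ∀ m n, m < n → (e (φ n) : I) < e (φ m) := fun m n hmn =>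
      lt_of_le_of_ne (not_lt.mp (h m n hmn)) fun heq =>
        hmn.ne' (φ.injective (e.injective (Subtype.ext heq)))
    exact (RelEmbedding.natGT (fun n => (e (φ n) : I)) fun n => hdec n _ n.lt_succ_self)
      |>.not_wellFounded wellFounded_lt
  set s : ℕ → I := fun n => e (φ n) with hs
  have hlim : ∀ c : ℕ → Y, ∃ y, Tendsto c (hyperfilter ℕ) (𝓝 y) := fun c => by
    obtain ⟨y, -, hy⟩ := isCompact_univ.ultrafilter_le_nhds ((hyperfilter ℕ).map c) (by simp)
    exact ⟨y, hy⟩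
  obtain ⟨y, hy⟩ := hlim fun n => a (s n)
  obtain ⟨z, hz⟩ := hlim fun n => b (s n)
  have hyz : y = z := by
    refine Subtype.ext (funext fun t => ?_)
    have hcoord : Continuous fun w : Y => (w : T → ℝ) t :=
      (continuous_apply t).comp continuous_subtype_val
    refine tendsto_nhds_unique_of_eventuallyEq ((hcoord.tendsto y).comp hy)
      ((hcoord.tendsto z).comp hz) ?_
    by_cases ht : ∃ n, t ∈ S (s n)
    · obtain ⟨n, hn⟩ := ht
      have hev : ∀ᶠ m in (hyperfilter ℕ : Filter ℕ), n ≤ m :=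
        Filter.Eventually.filter_mono Nat.hyperfilter_le_atTop (eventually_ge_atTop n)
      filter_upwards [hev] with m hm
      refine hab _ t (hS ?_ hn)
      rcases hm.eq_or_lt with rfl | hlt
      · rfl
      · exact (hφ n m hlt).le
    · push Not at ht
      refine Eventually.of_forall fun n => ?_
      have h1 : (a (s n) : T → ℝ) t = 0 := by
        by_contra h
        exact ht (n + 1) (ha _ _ (hφ n _ n.lt_succ_self) h)
      have h2 : (b (s n) : T → ℝ) t = 0 := by
        by_contra h
        exact ht (n + 1) (hb _ _ (hφ n _ n.lt_succ_self) h)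
      exact h1.trans h2.symm
  subst hyz
  have hdiff := (((hg.tendsto y).comp hy).sub ((hg.tendsto y).comp hz)).abs
  have hle := ge_of_tendsto hdiff (Eventually.of_forall fun n => (e (φ n)).2.le)
  simp only [sub_self, abs_zero] at hle
  exact hε.not_ge hle

/-- For `G` taking sets of size at most `κ` to sets of size at most `κ`, there is a family `S`
of sets of size at most `κ`, indexed by a well-order with initial segments of size at most `κ`,
such that each `S i` is the union of the sets `G (S j)` over `j < i`. -/
lemma exists_transfinite_iterate {T I : Type u} [LinearOrder I] [WellFoundedLT I]
    {κ : Cardinal.{u}} (hκ : ℵ₀ ≤ κ) (hI : ∀ i : I, #(Iio i) ≤ κ) (G : Set T → Set T)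
    (hG : ∀ R : Set T, #R ≤ κ → #(G R) ≤ κ) :
    ∃ S : I → Set T, (∀ i, #(S i) ≤ κ) ∧ ∀ i, S i = ⋃ j : Iio i, G (S j) := by
  let S : I → Set T := wellFounded_lt.fix fun i S => ⋃ j : Iio i, G (S j.1 j.2)
  have hS : ∀ i, S i = ⋃ j : Iio i, G (S j) := fun i => WellFounded.fix_eq _ _ i
  refine ⟨S, fun i => ?_, hS⟩
  induction i using WellFoundedLT.induction with
  | ind i ih =>
    rw [hS]
    exact mk_iUnion_le_of_le hκ (hI i) fun j => hG _ (ih j.1 j.2)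

/-- First step of the proof of Theorem 2.1: under the same hypotheses (density of `B` not
needed), for every `ε > 0` there is a set `R ⊆ T` with `|R| ≤ κ` such that any two
elements of `B` agreeing on `R` have `f`-values within `ε` of each other, uniformly in
the first variable. -/
theorem stmt_1 {X T : Type u} [TopologicalSpace X] (κ : Cardinal.{u})
    (hκ : Cardinal.aleph0 ≤ κ)
    (hX : ∀ 𝒰 : Set (Set X), (∀ U ∈ 𝒰, U.Nonempty ∧ FunctionallyOpen U) → PointFinite 𝒰 →
      Cardinal.mk ↥𝒰 ≤ κ)
    (Y : Set (T → ℝ)) (hYc : IsCompact Y)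
    (B : Set ↥Y) (hB : B = {y : ↥Y | Cardinal.mk ↥{t : T | (y : T → ℝ) t ≠ 0} ≤ κ})
    (f : X → ↥Y → ℝ)
    (hf1 : ∀ y : ↥Y, Continuous fun x : X => f x y) (hf2 : ∀ x : X, Continuous (f x))
    (ε : ℝ) (hε : 0 < ε) :
    ∃ R : Set T, Cardinal.mk ↥R ≤ κ ∧ ∀ b' ∈ B, ∀ b'' ∈ B,
      (∀ t ∈ R, (b' : T → ℝ) t = (b'' : T → ℝ) t) → ∀ x : X, |f x b' - f x b''| ≤ ε := by
  by_contra hcon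
  push Not at hcon
  have hchoose : ∀ R : Set T, ∃ p : Y × Y × X, #R ≤ κ →
      p.1 ∈ B ∧ p.2.1 ∈ B ∧ (∀ t ∈ R, (p.1 : T → ℝ) t = (p.2.1 : T → ℝ) t) ∧
        ε < |f p.2.2 p.1 - f p.2.2 p.2.1| := by
    intro R
    by_cases hR : #R ≤ κ
    · obtain ⟨b', hb', b'', hb'', h, x, hx⟩ := hcon R hR
      exact ⟨(b', b'', x), fun _ => ⟨hb', hb'', h, hx⟩⟩
    · obtain ⟨b', -, b'', -, -, x, -⟩ := hcon ∅ (by simp)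
      exact ⟨(b', b'', x), fun h => absurd h hR⟩
  choose p hp using hchoose
  let I := (Order.succ κ).ord.ToType
  have hI : ∀ i : I, #(Iio i) ≤ κ := fun i => Order.lt_succ_iff.mp <| by
    simpa [I] using mk_Iio_lt i (by simp [I])
  let G : Set T → Set T := fun R =>
    {t | ((p R).1 : T → ℝ) t ≠ 0} ∪ {t | ((p R).2.1 : T → ℝ) t ≠ 0}
  have hG : ∀ R : Set T, #R ≤ κ → #(G R) ≤ κ := by
    intro R hR
    obtain ⟨h1, h2, -⟩ := hp R hR
    rw [hB] at h1 h2
    exact (mk_union_le _ _).trans ((add_le_add h1 h2).trans (add_eq_self hκ).le)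
  obtain ⟨S, hSκ, hS⟩ := exists_transfinite_iterate hκ hI G hG
  have hsub : ∀ i j, i < j → G (S i) ⊆ S j := fun i j hij => by
    rw [hS j]
    exact subset_iUnion (fun k : Iio j => G (S k)) ⟨i, hij⟩
  have hmono : Monotone S := fun i j hij => by
    rw [hS i]
    exact iUnion_subset fun k => hsub _ _ (lt_of_lt_of_le k.2 hij)
  let U : I → Set X := fun i => {x | ε < |f x (p (S i)).1 - f x (p (S i)).2.1|}
  have hne : ∀ i, (U i).Nonempty := fun i => ⟨_, (hp (S i) (hSκ i)).2.2.2⟩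
  have hfin : ∀ x, {i | x ∈ U i}.Finite := fun x =>
    finite_setOf_lt_abs_sub hYc (fun i => (p (S i)).1) (fun i => (p (S i)).2.1) S hmono
      (fun i => (hp (S i) (hSκ i)).2.2.1)
      (fun i j hij => subset_union_left.trans (hsub i j hij))
      (fun i j hij => subset_union_right.trans (hsub i j hij)) (hf2 x) hε
  have hU : #(range U) ≤ κ := by
    refine hX _ ?_ fun x => ?_
    · rintro _ ⟨i, rfl⟩
      exact ⟨hne i, functionallyOpen_setOf_lt_abs ((hf1 _).sub (hf1 _)) ε⟩
    · refine ((hfin x).image U).subset ?_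
      rintro _ ⟨⟨i, rfl⟩, hx⟩
      exact ⟨i, hx, rfl⟩
  have hle := mk_le_of_finite_indices hκ U hne hfin hU
  rw [mk_ord_toType] at hle
  exact (Order.lt_succ κ).not_ge hle
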